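/- arXiv:1103.5479 — 4 statements merged into one kernel-verified Lean document; each statement's English description precedes it below -/
import Mathlib

section
/- Let n, r be positive integers with 2r ≤ n and let m ≥ 4nr − 4r². Let A₁, …, A_m : Ω → Matrix (Fin n) (Fin n) ℝ be a Gaussian measurement ensemble, i.e., the m·n² real entries of A₁(ω), …, A_m(ω) are i.i.d. standard Gaussian random variables. Then ℙ-almost surely the following holds: for every matrix M with rank M ≤ r and every matrix X with rank X ≤ r such that trace(Aᵢ(ω)ᵀ X) = trace(Aᵢ(ω)ᵀ M) for all i = 1, …, m, one has X = M. (That is, rank minimization recovers every rank-r matrix from its m Gaussian measurements with probability 1.) -/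
open MeasureTheory ProbabilityTheory Matrix

namespace MeasureTheory.Measure

/-- A finite product of measures is absolutely continuous with respect to the product of
dominating measures, for products indexed by `Fin k`. -/
theorem pi_fin_absolutelyContinuous {k : ℕ} {α : Fin k → Type*} [∀ i, MeasurableSpace (α i)]
    {μ ν : ∀ i, Measure (α i)} [∀ i, SigmaFinite (μ i)] [∀ i, SigmaFinite (ν i)]
    (h : ∀ i, μ i ≪ ν i) : Measure.pi μ ≪ Measure.pi ν := by
  induction k with
  | zero =>
    rw [Measure.pi_of_empty, Measure.pi_of_empty]
  | succ k ih =>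
    rw [← ((measurePreserving_piFinSuccAbove μ 0).symm _).map_eq,
      ← ((measurePreserving_piFinSuccAbove ν 0).symm _).map_eq]
    exact ((h 0).prod (ih fun i => h _)).map (MeasurableEquiv.measurable _)

/-- A finite product of measures is absolutely continuous with respect to the product of
dominating measures. -/
theorem pi_absolutelyContinuous {ι : Type*} [Fintype ι] {α : ι → Type*}
    [∀ i, MeasurableSpace (α i)] {μ ν : ∀ i, Measure (α i)}
    [∀ i, SigmaFinite (μ i)] [∀ i, SigmaFinite (ν i)]
    (h : ∀ i, μ i ≪ ν i) : Measure.pi μ ≪ Measure.pi ν := by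
  let e := (Fintype.equivFin ι).symm
  rw [← (measurePreserving_piCongrLeft μ e).map_eq, ← (measurePreserving_piCongrLeft ν e).map_eq]
  exact (pi_fin_absolutelyContinuous fun i => h (e i)).map (MeasurableEquiv.measurable _)

end MeasureTheory.Measure

/-- The range of a `C¹` map from a space of dimension less than `card ι` is a null set. -/
theorem ContDiff.volume_range_eq_zero {E ι : Type*} [NormedAddCommGroup E] [NormedSpace ℝ E]
    [FiniteDimensional ℝ E] [Fintype ι] {f : E → ι → ℝ} (hf : ContDiff ℝ 1 f)
    (hdim : Module.finrank ℝ E < Fintype.card ι) : volume (Set.range f) = 0 := by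
  rw [← hausdorffMeasure_pi_real]
  have h : dimH (Set.range f) < ((Fintype.card ι : NNReal) : ENNReal) :=
    hf.dimH_range_le.trans_lt (by simpa using hdim)
  simpa using hausdorffMeasure_of_dimH_lt h

/-- If a `C¹` family of vectors has fewer than `m` parameters, then almost every system of `m`
linear forms has no common zero among the members of the family whose `k₀`-th coordinate is `1`. -/
theorem volume_setOf_exists_common_zero {E κ : Type*} [NormedAddCommGroup E] [NormedSpace ℝ E]
    [FiniteDimensional ℝ E] [Fintype κ] {m : ℕ} {Z : E → κ → ℝ} (hZ : ContDiff ℝ 1 Z)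
    (k₀ : κ) (hdim : Module.finrank ℝ E < m) :
    volume {a : Fin m × κ → ℝ | ∃ e, Z e k₀ = 1 ∧ ∀ i, ∑ k, a (i, k) * Z e k = 0} = 0 := by
  classical
  let f : E × (Fin m × {k // k ≠ k₀} → ℝ) → Fin m × κ → ℝ := fun y x =>
    if h : x.2 = k₀ then -∑ k : {k // k ≠ k₀}, y.2 (x.1, k) * Z y.1 k else y.2 (x.1, ⟨x.2, h⟩)
  have hZ' (k : κ) : ContDiff ℝ 1 fun e => Z e k := contDiff_pi.1 hZ k
  have hf : ContDiff ℝ 1 f := by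
    refine contDiff_pi.2 fun x => ?_
    by_cases h : x.2 = k₀
    · simp only [f, h, dite_true]
      fun_prop
    · simp only [f, h, dite_false]
      fun_prop
  refine measure_mono_null ?_ (hf.volume_range_eq_zero ?_)
  · rintro a ⟨e, he, ha⟩
    refine ⟨(e, fun x => a (x.1, x.2)), funext fun ⟨i, k⟩ => ?_⟩
    by_cases h : k = k₀
    · subst h
      have hi := ha i
      rw [← Fintype.sum_subtype_add_sum_subtype (fun j => j ≠ k)] at hi
      have : ∑ j : {j // ¬ j ≠ k}, a (i, j) * Z e j = a (i, k) := by
        rw [Fintype.sum_eq_single ⟨k, by simp⟩ fun j hj =>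
          (hj (Subtype.ext (not_not.1 j.2))).elim]
        simp [he]
      simp only [f, dite_true]
      linarith
    · simp [f, h]
  · have hκ : 0 < Fintype.card κ := Fintype.card_pos_iff.2 ⟨k₀⟩
    obtain ⟨c, hc⟩ := Nat.exists_eq_add_of_lt hκ
    simp only [Module.finrank_prod, Module.finrank_fintype_fun_eq_card, Fintype.card_prod,
      Fintype.card_fin, ne_eq, Fintype.card_subtype_compl, Fintype.card_subtype_eq, hc]
    have : 0 + c + 1 - 1 = c := by omega
    rw [this]
    nlinarith

namespace Matrix

theorem rank_sub_le_rank_add_rank {n : ℕ} (X Y : Matrix (Fin n) (Fin n) ℝ) :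
    (X - Y).rank ≤ X.rank + Y.rank := by
  refine le_trans (Submodule.finrank_mono ?_) (Submodule.finrank_add_le_finrank_add_finrank _ _)
  rintro _ ⟨v, rfl⟩
  rw [mulVecLin_apply, sub_mulVec]
  exact Submodule.sub_mem _ (Submodule.mem_sup_left ⟨v, rfl⟩) (Submodule.mem_sup_right ⟨v, rfl⟩)

/-- A matrix with `n` columns of rank at most `s ≤ n` has `s` columns that span all of them. -/
theorem exists_finset_columns_span {n s : ℕ} (Z : Matrix (Fin n) (Fin n) ℝ) (hs : s ≤ n)
    (hZ : Z.rank ≤ s) :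
    ∃ J : Finset (Fin n), J.card = s ∧
      ∀ l, ∃ w : J → ℝ, ∀ k, Z k l = ∑ j : J, Z k j * w j := by
  classical
  obtain ⟨κ, a, ha, hspan, hli⟩ := exists_linearIndependent' ℝ Z.col
  have : Fintype κ := Fintype.ofInjective a ha
  have hcard : (Finset.univ.image a).card ≤ s := by
    rw [Finset.card_image_of_injective _ ha, Finset.card_univ, ← finrank_span_eq_card hli, hspan,
      ← Z.rank_eq_finrank_span_cols]
    exact hZ
  obtain ⟨J, hJ, hJs⟩ := Finset.exists_superset_card_eq hcard (by simpa using hs)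
  refine ⟨J, hJs, fun l => ?_⟩
  have hl : Z.col l ∈ Submodule.span ℝ (Z.col '' J) := by
    have h : Z.col l ∈ Submodule.span ℝ (Set.range (Z.col ∘ a)) :=
      hspan ▸ Submodule.subset_span ⟨l, rfl⟩
    refine Submodule.span_mono ?_ h
    rintro _ ⟨k, rfl⟩
    exact ⟨a k, hJ (by simp), rfl⟩
  obtain ⟨w, hw⟩ := Submodule.mem_span_image_finset_iff_exists_fun ℝ |>.1 hl
  refine ⟨w, fun k => ?_⟩
  have := congrFun hw k
  simp only [Finset.sum_apply, Pi.smul_apply, smul_eq_mul, col_apply] at this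
  rw [← this]
  exact Finset.sum_congr rfl fun j _ => mul_comm _ _

section LowRankChart

variable {n : ℕ} (J : Finset (Fin n)) (p : Fin n) (q : J)

/-- Parameters of `lowRankChart`: the columns in `J` apart from the entry `(p, q)`, and the
coefficients expressing the remaining columns in terms of them. -/
abbrev LowRankParam : Type :=
  ({x : Fin n × J // x ≠ (p, q)} → ℝ) × (J × {l // l ∉ J} → ℝ)

/-- The block of columns in `J`, with entry `1` at `(p, q)`. -/
def columnBlock (c : {x : Fin n × J // x ≠ (p, q)} → ℝ) (k : Fin n) (j : J) : ℝ :=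
  if h : (k, j) = (p, q) then 1 else c ⟨(k, j), h⟩

/-- Parametrization of the matrices with entry `1` at `(p, q)` whose columns are all linear
combinations of the columns in `J`. -/
def lowRankChart (e : LowRankParam J p q) (x : Fin n × Fin n) : ℝ :=
  if h : x.2 ∈ J then columnBlock J p q e.1 x.1 ⟨x.2, h⟩
  else ∑ j : J, columnBlock J p q e.1 x.1 j * e.2 (j, ⟨x.2, h⟩)

theorem contDiff_lowRankChart : ContDiff ℝ 1 (lowRankChart J p q) := by
  have hC (k : Fin n) (j : J) :
      ContDiff ℝ 1 fun e : LowRankParam J p q => columnBlock J p q e.1 k j := by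
    unfold columnBlock
    split_ifs <;> fun_prop
  refine contDiff_pi.2 fun x => ?_
  unfold lowRankChart
  split_ifs <;> fun_prop

theorem finrank_lowRankParam :
    Module.finrank ℝ (LowRankParam J p q) = n * J.card - 1 + J.card * (n - J.card) := by
  simp [LowRankParam, Fintype.card_subtype_compl]

/-- Every nonzero matrix of rank at most `s` is a multiple of a member of one of the charts. -/
theorem exists_lowRankChart_eq {s : ℕ} (Z : Matrix (Fin n) (Fin n) ℝ) (hs : s ≤ n)
    (hZ : Z.rank ≤ s) (hZ0 : Z ≠ 0) :
    ∃ (J : Finset (Fin n)) (p : Fin n) (q : J) (e : LowRankParam J p q) (t : ℝ),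
      J.card = s ∧ lowRankChart J p q e (p, q) = 1 ∧
        ∀ x, lowRankChart J p q e x = t * Z x.1 x.2 := by
  obtain ⟨J, hJ, hw⟩ := Z.exists_finset_columns_span hs hZ
  choose w hw using hw
  obtain ⟨p, l, hpl⟩ : ∃ p l, Z p l ≠ 0 := by
    by_contra! h
    exact hZ0 (Matrix.ext h)
  rw [hw] at hpl
  obtain ⟨⟨q, hq⟩, -, hpq⟩ := Finset.exists_ne_zero_of_sum_ne_zero hpl
  have hpq : Z p q ≠ 0 := left_ne_zero_of_mul hpq
  let e : LowRankParam J p ⟨q, hq⟩ :=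
    (fun x => (Z p q)⁻¹ * Z x.1.1 x.1.2, fun x => w x.2 x.1)
  have hC (k : Fin n) (j : J) : columnBlock J p ⟨q, hq⟩ e.1 k j = (Z p q)⁻¹ * Z k j := by
    unfold columnBlock
    split_ifs with h
    · obtain ⟨rfl, rfl⟩ := Prod.mk.inj h
      simp [hpq]
    · rfl
  have he (x : Fin n × Fin n) :
      lowRankChart J p ⟨q, hq⟩ e x = (Z p q)⁻¹ * Z x.1 x.2 := by
    unfold lowRankChart
    split_ifs with h
    · exact hC _ _
    · simp only [hC]
      rw [hw x.2 x.1, Finset.mul_sum]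
      exact Finset.sum_congr rfl fun j _ => mul_assoc _ _ _
  exact ⟨J, p, ⟨q, hq⟩, e, (Z p q)⁻¹, hJ, by simp [he, hpq], he⟩

end LowRankChart

/-- For almost every system of `m` linear forms on `n × n` matrices, where
`m ≥ n * s + s * (n - s)`, the only common zero of rank at most `s` is the zero matrix. -/
theorem ae_eq_zero_of_rank_le {n s m : ℕ} (hs0 : 0 < s) (hs : s ≤ n)
    (hm : n * s + s * (n - s) ≤ m) :
    ∀ᵐ a : Fin m × Fin n × Fin n → ℝ, ∀ Z : Matrix (Fin n) (Fin n) ℝ, Z.rank ≤ s →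
      (∀ i, ∑ x : Fin n × Fin n, a (i, x) * Z x.1 x.2 = 0) → Z = 0 := by
  have hchart (J : Finset (Fin n)) (p : Fin n) (q : J) : ∀ᵐ a : Fin m × Fin n × Fin n → ℝ,
      J.card = s → ¬ ∃ e, lowRankChart J p q e (p, q) = 1 ∧
        ∀ i, ∑ x, a (i, x) * lowRankChart J p q e x = 0 := by
    by_cases hJ : J.card = s
    · have hdim : Module.finrank ℝ (LowRankParam J p q) < m := by
        rw [finrank_lowRankParam, hJ]
        have : 0 < n * s := Nat.mul_pos (hs0.trans_le hs) hs0
        omega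
      simpa [ae_iff, hJ] using
        volume_setOf_exists_common_zero (contDiff_lowRankChart J p q) (p, (q : Fin n)) hdim
    · simp [hJ]
  simp only [← ae_all_iff] at hchart
  filter_upwards [hchart] with a ha Z hZ hzero
  by_contra hZ0
  obtain ⟨J, p, q, e, t, hJ, hone, he⟩ := exists_lowRankChart_eq Z hs hZ hZ0
  refine ha J p q hJ ⟨e, hone, fun i => ?_⟩
  simp only [he, mul_left_comm _ t, ← Finset.mul_sum, hzero, mul_zero]

end Matrix

/-- **Strong recovery by rank minimization (Theorem 1).**
If `m ≥ 4nr - 4r²` and the `m·n²` entries of the random measurement matrices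
`A 1, …, A m` are i.i.d. standard Gaussians, then almost surely rank minimization
recovers every matrix of rank at most `r` from its `m` measurements
`X ↦ trace (Aᵢᵀ X)`. -/
theorem strong_recovery_gaussian
    {Ω : Type*} [MeasurableSpace Ω] (P : Measure Ω) [IsProbabilityMeasure P]
    (n r m : ℕ) (hn : 0 < n) (hr : 0 < r) (h2r : 2 * r ≤ n)
    (hm : 4 * n * r - 4 * r ^ 2 ≤ m)
    (A : Fin m → Ω → Matrix (Fin n) (Fin n) ℝ)
    (hiid : Measure.map (fun ω => fun p : Fin m × Fin n × Fin n => A p.1 ω p.2.1 p.2.2) P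
      = Measure.pi fun _ : Fin m × Fin n × Fin n => gaussianReal 0 1) :
    ∀ᵐ ω ∂P, ∀ M X : Matrix (Fin n) (Fin n) ℝ,
      M.rank ≤ r → X.rank ≤ r →
      (∀ i : Fin m, ((A i ω)ᵀ * X).trace = ((A i ω)ᵀ * M).trace) → X = M := by
  have hmeas : AEMeasurable
      (fun ω => fun p : Fin m × Fin n × Fin n => A p.1 ω p.2.1 p.2.2) P := by
    by_contra h
    rw [Measure.map_of_not_aemeasurable h] at hiid
    exact IsProbabilityMeasure.ne_zero _ hiid.symm
  have hac : (Measure.pi fun _ : Fin m × Fin n × Fin n => gaussianReal 0 1) ≪ volume :=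
    Measure.pi_absolutelyContinuous fun _ => gaussianReal_absolutelyContinuous 0 one_ne_zero
  have hdim : n * (2 * r) + 2 * r * (n - 2 * r) ≤ m := by
    obtain ⟨t, rfl⟩ := Nat.exists_eq_add_of_le h2r
    refine le_trans ?_ hm
    rw [Nat.add_sub_cancel_left]
    exact Nat.le_sub_of_add_le (by nlinarith)
  have hae := ae_of_ae_map hmeas <| hiid ▸ hac.ae_le
    (ae_eq_zero_of_rank_le (s := 2 * r) (by omega) h2r hdim)
  filter_upwards [hae] with ω hω M X hM hX hMX
  refine sub_eq_zero.1 (hω (X - M) ?_ fun i => ?_)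
  · have := rank_sub_le_rank_add_rank X M
    omega
  · have h : ((A i ω)ᵀ * (X - M)).trace = 0 := by
      rw [Matrix.mul_sub, trace_sub, hMX, sub_self]
    rw [← h, trace, Fintype.sum_prod_type_right]
    simp [Matrix.mul_apply]
end

section
/- Let n, r be positive integers with r ≤ n, and fix a matrix M ∈ Matrix (Fin n) (Fin n) ℝ with rank M ≤ r. Let m ≥ 2nr − r² + 1 and let A₁, …, A_m : Ω → Matrix (Fin n) (Fin n) ℝ be a Gaussian measurement ensemble, i.e., the m·n² real entries of A₁(ω), …, A_m(ω) are i.i.d. standard Gaussian random variables. Then ℙ-almost surely: for every matrix X with rank X ≤ r such that trace(Aᵢ(ω)ᵀ X) = trace(Aᵢ(ω)ᵀ M) for all i = 1, …, m, one has X = M. (That is, the fixed matrix M is recovered by rank minimization with probability 1.) -/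
open MeasureTheory ProbabilityTheory Matrix

theorem pi_fin_absolutelyContinuous {n : ℕ} {α : Type*} [MeasurableSpace α]
    {μ ν : Fin n → Measure α} [∀ i, SigmaFinite (μ i)] [∀ i, SigmaFinite (ν i)]
    (h : ∀ i, μ i ≪ ν i) : Measure.pi μ ≪ Measure.pi ν := by
  induction n with
  | zero => rw [Subsingleton.elim μ ν]
  | succ n ih =>
    have hμ := (measurePreserving_piFinSuccAbove μ 0).symm
    have hν := (measurePreserving_piFinSuccAbove ν 0).symm
    rw [← hμ.map_eq, ← hν.map_eq]
    exact ((h 0).prod (ih fun j => h _)).map (MeasurableEquiv.measurable _)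

theorem pi_absolutelyContinuous {ι α : Type*} [Fintype ι] [MeasurableSpace α]
    {μ ν : ι → Measure α} [∀ i, SigmaFinite (μ i)] [∀ i, SigmaFinite (ν i)]
    (h : ∀ i, μ i ≪ ν i) : Measure.pi μ ≪ Measure.pi ν := by
  let e := (Fintype.equivFin ι).symm
  rw [← (measurePreserving_piCongrLeft μ e).map_eq, ← (measurePreserving_piCongrLeft ν e).map_eq]
  exact (pi_fin_absolutelyContinuous fun i => h (e i)).map (MeasurableEquiv.measurable _)

theorem volume_setOf_apply_eq_zero {ι : Type*} [Fintype ι] (i : ι) :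
    volume {a : ι → ℝ | a i = 0} = 0 := by
  classical
  refine Measure.addHaar_submodule volume (LinearMap.ker (LinearMap.proj (R := ℝ)
    (φ := fun _ : ι => ℝ) i)) fun h => ?_
  have : Pi.single i (1 : ℝ) ∈ LinearMap.ker (LinearMap.proj (R := ℝ) (φ := fun _ : ι => ℝ) i) :=
    h ▸ Submodule.mem_top
  simp at this

/-- If a family of vectors `Y t` depends differentiably on fewer parameters than there are
linear forms, then almost no tuple of linear forms has a common nonzero zero in the family.
This version concerns zeros whose coordinate `p` does not vanish. -/
theorem volume_setOf_exists_common_zero_of_apply_ne_zero {ι κ τ : Type*} [Fintype ι] [Fintype κ]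
    [Fintype τ] (hcard : Fintype.card κ < Fintype.card ι) {Y : (κ → ℝ) → τ → ℝ}
    (hY : Differentiable ℝ Y) (p : τ) :
    volume {a : ι × τ → ℝ | ∃ t, Y t p ≠ 0 ∧ ∀ i, ∑ k, a (i, k) * Y t k = 0} = 0 := by
  classical
  obtain ⟨g⟩ : Nonempty (κ ↪ ι) := Function.Embedding.nonempty_of_card_le hcard.le
  obtain ⟨i₀, hi₀⟩ : ∃ i₀, ∀ k, g k ≠ i₀ := by
    by_contra! h
    exact hcard.not_ge (Fintype.card_le_of_surjective g h)
  let T : (ι × τ → ℝ) → κ → ℝ := fun a k => a (g k, p)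
  let s : Set (ι × τ → ℝ) := {a | a (i₀, p) = 0 ∧ Y (T a) p ≠ 0}
  let f : (ι × τ → ℝ) → ι × τ → ℝ := fun a q =>
    if q.2 = p then -(∑ k ∈ Finset.univ.erase p, a (q.1, k) * Y (T a) k) / Y (T a) p else a q
  have hT : Differentiable ℝ T := by fun_prop
  have hYT (k : τ) : Differentiable ℝ fun a => Y (T a) k :=
    differentiable_pi.1 (hY.comp hT) k
  have hf : DifferentiableOn ℝ f s := by
    refine differentiableOn_pi.2 fun q => ?_
    by_cases hq : q.2 = p
    · simp only [f, hq, if_true, div_eq_mul_inv]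
      refine DifferentiableOn.fun_mul (Differentiable.differentiableOn ?_)
        ((hYT p).differentiableOn.fun_inv fun a ha => ha.2)
      exact (Differentiable.fun_sum fun k _ => (differentiable_apply _).mul (hYT k)).neg
    · simp only [f, hq, if_false]
      exact (differentiable_apply q).differentiableOn
  have hs : volume s = 0 :=
    measure_mono_null (fun a ha => ha.1) (volume_setOf_apply_eq_zero (i₀, p))
  refine measure_mono_null ?_
    (addHaar_image_eq_zero_of_differentiableOn_of_addHaar_eq_zero volume hf hs)
  rintro a ⟨t, htp, ht⟩
  let b : ι × τ → ℝ := fun q => if q.2 = p then Function.extend g t 0 q.1 else a q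
  have hTb : T b = t := by
    funext k
    simp [T, b, g.injective.extend_apply]
  refine ⟨b, ⟨?_, by rwa [hTb]⟩, ?_⟩
  · simpa [b] using Function.extend_apply' t (0 : ι → ℝ) i₀ (by simpa using hi₀)
  · funext ⟨i, q⟩
    by_cases hq : q = p
    · subst hq
      have hsum : ∑ k ∈ Finset.univ.erase q, b (i, k) * Y t k
          = ∑ k ∈ Finset.univ.erase q, a (i, k) * Y t k :=
        Finset.sum_congr rfl fun k hk => by simp [b, Finset.ne_of_mem_erase hk]
      have := ht i
      rw [← Finset.add_sum_erase _ _ (Finset.mem_univ q)] at this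
      simp only [f, if_true, hTb, hsum]
      rw [div_eq_iff htp]
      linarith
    · simp [f, b, hq]

theorem volume_setOf_exists_common_zero_s2 {ι κ τ : Type*} [Fintype ι] [Fintype κ]
    [Fintype τ] (hcard : Fintype.card κ < Fintype.card ι) {Y : (κ → ℝ) → τ → ℝ}
    (hY : Differentiable ℝ Y) :
    volume {a : ι × τ → ℝ | ∃ t, Y t ≠ 0 ∧ ∀ i, ∑ k, a (i, k) * Y t k = 0} = 0 := by
  refine measure_mono_null ?_ (measure_iUnion_null fun p =>
    volume_setOf_exists_common_zero_of_apply_ne_zero hcard hY p)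
  rintro a ⟨t, hne, ht⟩
  obtain ⟨p, hp⟩ := Function.ne_iff.1 hne
  exact Set.mem_iUnion.2 ⟨p, t, hp, ht⟩

/-- The matrix whose columns indexed by `ρ` are free parameters, and whose columns indexed by `σ`
are linear combinations of these, with free coefficients. -/
def columnChart {ν ρ σ : Type*} [Fintype ρ] (e : ρ ⊕ σ ≃ ν) (t : ν × ρ ⊕ ρ × σ → ℝ) :
    Matrix ν ν ℝ :=
  .of fun i j => Sum.elim (fun a => t (.inl (i, a)))
    (fun b => ∑ a, t (.inr (a, b)) * t (.inl (i, a))) (e.symm j)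

theorem differentiable_columnChart_apply {ν ρ σ : Type*} [Fintype ν] [Fintype ρ] [Fintype σ]
    (e : ρ ⊕ σ ≃ ν) (i j : ν) : Differentiable ℝ fun t => columnChart e t i j := by
  rcases h : e.symm j with a | b <;>
    simp only [columnChart, of_apply, h, Sum.elim_inl, Sum.elim_inr] <;> fun_prop

theorem exists_columnChart_eq {n r : ℕ} (hrn : r ≤ n) (X : Matrix (Fin n) (Fin n) ℝ)
    (hX : X.rank ≤ r) : ∃ (e : Fin r ⊕ Fin (n - r) ≃ Fin n) (t : _), columnChart e t = X := by
  classical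
  obtain ⟨κ, c, hc, hspan, hli⟩ := exists_linearIndependent' ℝ X.col
  have : Finite κ := Finite.of_injective c hc
  have := Fintype.ofFinite κ
  have hκ : Fintype.card κ ≤ r := by
    rwa [← finrank_span_eq_card hli, hspan, ← rank_eq_finrank_span_cols]
  obtain ⟨J, hJ, hJr⟩ := Finset.exists_superset_card_eq (s := Finset.univ.image c) (n := r)
    (Finset.card_image_le.trans hκ) (by simpa using hrn)
  let e : Fin r ⊕ Fin (n - r) ≃ Fin n :=
    finSumEquivOfFinset hJr (by rw [Finset.card_compl, hJr, Fintype.card_fin])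
  have hmem (j : Fin n) : X.col j ∈ Submodule.span ℝ (Set.range fun a => X.col (e (.inl a))) := by
    have h : X.col j ∈ Submodule.span ℝ (Set.range (X.col ∘ c)) :=
      hspan ▸ Submodule.subset_span ⟨j, rfl⟩
    refine Submodule.span_mono ?_ h
    rintro _ ⟨k, rfl⟩
    have hk : c k ∈ Set.range (J.orderEmbOfFin hJr) := by
      rw [Finset.range_orderEmbOfFin]
      exact hJ (Finset.mem_image_of_mem c (Finset.mem_univ k))
    obtain ⟨a, ha⟩ := hk
    exact ⟨a, congrArg X.col ha⟩
  choose w hw using fun j => Submodule.mem_span_range_iff_exists_fun ℝ |>.1 (hmem j)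
  refine ⟨e, Sum.elim (fun q => X q.1 (e (.inl q.2))) (fun q => w (e (.inr q.2)) q.1), ?_⟩
  ext i j
  obtain ⟨q, rfl⟩ := e.surjective j
  rcases q with a | b
  · simp [columnChart]
  · simpa [columnChart] using congrFun (hw (e (.inr b))) i

theorem trace_transpose_mul_eq_sum {ν : Type*} [Fintype ν] (A X : Matrix ν ν ℝ) :
    (Aᵀ * X).trace = ∑ q : ν × ν, A q.1 q.2 * X q.1 q.2 := by
  simp only [trace, diag_apply, mul_apply, transpose_apply, Fintype.sum_prod_type]
  exact Finset.sum_comm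

/-- **Weak recovery by rank minimization (Theorem 2).**
Fix a matrix `M` of rank at most `r`.  If `m ≥ 2nr - r² + 1` and the `m·n²` entries of
the random measurement matrices `A 1, …, A m` are i.i.d. standard Gaussians, then
almost surely `M` is the unique matrix of rank at most `r` with the measurements
`trace (Aᵢᵀ M)`. -/
theorem weak_recovery_gaussian
    {Ω : Type*} [MeasurableSpace Ω] (P : Measure Ω) [IsProbabilityMeasure P]
    (n r m : ℕ) (hn : 0 < n) (hr : 0 < r) (hrn : r ≤ n)
    (M : Matrix (Fin n) (Fin n) ℝ) (hM : M.rank ≤ r)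
    (hm : 2 * n * r - r ^ 2 + 1 ≤ m)
    (A : Fin m → Ω → Matrix (Fin n) (Fin n) ℝ)
    (hiid : Measure.map (fun ω => fun p : Fin m × Fin n × Fin n => A p.1 ω p.2.1 p.2.2) P
      = Measure.pi fun _ : Fin m × Fin n × Fin n => gaussianReal 0 1) :
    ∀ᵐ ω ∂P, ∀ X : Matrix (Fin n) (Fin n) ℝ,
      X.rank ≤ r →
      (∀ i : Fin m, ((A i ω)ᵀ * X).trace = ((A i ω)ᵀ * M).trace) → X = M := by
  have hcard : Fintype.card (Fin n × Fin r ⊕ Fin r × Fin (n - r)) < Fintype.card (Fin m) := by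
    obtain ⟨k, rfl⟩ := Nat.exists_eq_add_of_le hrn
    have : 2 * (r + k) * r - r ^ 2 = (r + k) * r + r * k :=
      Nat.sub_eq_of_eq_add (by ring)
    simp only [Fintype.card_sum, Fintype.card_prod, Fintype.card_fin, Nat.add_sub_cancel_left]
    omega
  let Y (e : Fin r ⊕ Fin (n - r) ≃ Fin n) (t : Fin n × Fin r ⊕ Fin r × Fin (n - r) → ℝ)
    (q : Fin n × Fin n) : ℝ := columnChart e t q.1 q.2 - M q.1 q.2
  have hY (e) : Differentiable ℝ (Y e) := differentiable_pi.2 fun q =>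
    (differentiable_columnChart_apply e q.1 q.2).sub_const _
  have hnull := measure_iUnion_null fun e => volume_setOf_exists_common_zero_s2 hcard (hY e)
  have hac : (Measure.pi fun _ : Fin m × Fin n × Fin n => gaussianReal 0 1) ≪ volume :=
    pi_absolutelyContinuous fun _ => gaussianReal_absolutelyContinuous 0 one_ne_zero
  have hmeas : AEMeasurable (fun ω => fun p : Fin m × Fin n × Fin n => A p.1 ω p.2.1 p.2.2) P :=
    AEMeasurable.of_map_ne_zero (hiid ▸ IsProbabilityMeasure.ne_zero _)
  have hae := ae_of_ae_map hmeas (hiid ▸ measure_eq_zero_iff_ae_notMem.1 (hac hnull))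
  filter_upwards [hae] with ω hω X hX hAX
  by_contra hne
  obtain ⟨e, t, rfl⟩ := exists_columnChart_eq hrn X hX
  refine hω (Set.mem_iUnion.2 ⟨e, t, fun h => hne ?_, fun i => ?_⟩)
  · ext i j
    exact sub_eq_zero.1 (congrFun h (i, j))
  · have := hAX i
    rw [trace_transpose_mul_eq_sum, trace_transpose_mul_eq_sum, ← sub_eq_zero,
      ← Finset.sum_sub_distrib] at this
    simpa only [Y, mul_sub] using this
end

section
/- Let 𝒜 : Matrix (Fin n) (Fin n) ℝ →ₗ[ℝ] (Fin m → ℝ) be a linear map and r a positive integer with 2r ≤ n. The following are equivalent: (1) for all matrices M, X with rank M ≤ r and rank X ≤ r, 𝒜(X) = 𝒜(M) implies X = M (uniform recovery of all rank-r matrices by rank minimization); (2) there is no nonzero matrix Z with rank Z ≤ 2r and 𝒜(Z) = 0 (the null space of 𝒜 contains no nonzero matrix of rank at most 2r). -/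
open Matrix

theorem Matrix.rank_add_le_add {ι κ K : Type*} [Finite ι] [Fintype κ] [Field K]
    (A B : Matrix ι κ K) : (A + B).rank ≤ A.rank + B.rank := by
  rw [Matrix.rank, Matrix.mulVecLin_add]
  exact (Submodule.finrank_mono (LinearMap.range_add_le _ _)).trans
    (Submodule.finrank_add_le_finrank_add_finrank _ _)

theorem Matrix.rank_neg_le {ι κ K : Type*} [Fintype κ] [Field K]
    (A : Matrix ι κ K) : (-A).rank ≤ A.rank := by
  classical
  simpa using Matrix.rank_mul_le_left A (-1 : Matrix κ κ K)

theorem Matrix.rank_diagonal_ite_mem_le {ι K : Type*} [Fintype ι] [DecidableEq ι] [Field K]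
    (t : Finset ι) (D : ι → K) :
    (Matrix.diagonal fun i => if i ∈ t then D i else 0).rank ≤ t.card := by
  refine Matrix.rank_le_card_of_support_subset _ t fun i hi => ?_
  by_contra hit
  refine hi (funext fun j => ?_)
  have hit' : i ∉ t := hit
  simp [Matrix.row, Matrix.diagonal_apply, hit']

/-- A square matrix of rank at most `a + b` is the sum of a matrix of rank at most `a` and a
matrix of rank at most `b`. -/
theorem Matrix.exists_add_eq_of_rank_le_add {ι K : Type*} [Fintype ι] [DecidableEq ι] [Field K]
    (Z : Matrix ι ι K) {a b : ℕ} (hZ : Z.rank ≤ a + b) :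
    ∃ X Y : Matrix ι ι K, X.rank ≤ a ∧ Y.rank ≤ b ∧ X + Y = Z := by
  classical
  obtain ⟨V, U, D, hV, hU, rfl⟩ : ∃ (V U : Matrix ι ι K) (D : ι → K),
      IsUnit V.det ∧ IsUnit U.det ∧ Z = V * Matrix.diagonal D * U := by
    obtain ⟨L, L', D, h⟩ :=
      Matrix.Pivot.exists_list_transvec_mul_diagonal_mul_list_transvec Z
    exact ⟨_, _, D, by simp, by simp, h⟩
  have rank_mul_mul_le (E : Matrix ι ι K) : (V * E * U).rank ≤ E.rank :=
    (Matrix.rank_mul_le_left _ _).trans (Matrix.rank_mul_le_right _ _)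
  rw [Matrix.rank_mul_eq_left_of_isUnit_det _ _ hU, Matrix.rank_mul_eq_right_of_isUnit_det _ _ hV,
    Matrix.rank_diagonal, Fintype.card_subtype] at hZ
  set s : Finset ι := {i | D i ≠ 0}
  obtain ⟨t, hts, ht⟩ := Finset.exists_subset_card_eq (min_le_right a s.card)
  refine ⟨V * Matrix.diagonal (fun i => if i ∈ t then D i else 0) * U,
    V * Matrix.diagonal (fun i => if i ∈ s \ t then D i else 0) * U, ?_, ?_, ?_⟩
  · exact (rank_mul_mul_le _).trans ((Matrix.rank_diagonal_ite_mem_le t D).trans (by omega))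
  · refine (rank_mul_mul_le _).trans ((Matrix.rank_diagonal_ite_mem_le (s \ t) D).trans ?_)
    rw [Finset.card_sdiff_of_subset hts]
    omega
  · rw [← Matrix.add_mul, ← Matrix.mul_add, Matrix.diagonal_add]
    congr 3
    funext i
    by_cases hit : i ∈ t <;> by_cases hi : D i = 0 <;> simp [s, hit, hi]

/-- The null-space characterization of uniform recovery: a measurement operator `𝒜`
recovers every matrix of rank at most `r` by rank minimization if and only if its null
space contains no nonzero matrix of rank at most `2r`. -/
theorem uniform_recovery_iff_nullspace
    (n m r : ℕ) (hr : 0 < r) (h2r : 2 * r ≤ n)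
    (𝒜 : Matrix (Fin n) (Fin n) ℝ →ₗ[ℝ] (Fin m → ℝ)) :
    (∀ M X : Matrix (Fin n) (Fin n) ℝ,
        M.rank ≤ r → X.rank ≤ r → 𝒜 X = 𝒜 M → X = M) ↔
      (¬ ∃ Z : Matrix (Fin n) (Fin n) ℝ, Z ≠ 0 ∧ Z.rank ≤ 2 * r ∧ 𝒜 Z = 0) := by
  constructor
  · rintro hrec ⟨Z, hZ0, hZ, hAZ⟩
    obtain ⟨X, Y, hX, hY, rfl⟩ := Z.exists_add_eq_of_rank_le_add (hZ.trans_eq (two_mul r))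
    have hXY : X = -Y := hrec (-Y) X (Y.rank_neg_le.trans hY) hX (by
      rwa [map_neg, ← add_eq_zero_iff_eq_neg, ← map_add])
    exact hZ0 (by rw [hXY, neg_add_cancel])
  · intro hnull M X hM hX hA
    by_contra hne
    refine hnull ⟨X - M, sub_ne_zero.mpr hne, ?_, by rw [map_sub, hA, sub_self]⟩
    have hadd := X.rank_add_le_add (-M)
    have hneg := M.rank_neg_le
    rw [sub_eq_add_neg]
    omega
end

section
/- Let A : Ω → Matrix (Fin n) (Fin n) ℝ be a random matrix on a probability space (Ω, ℙ) whose n² entries are i.i.d. with law gaussianReal 0 1, and let X ∈ Matrix (Fin n) (Fin n) ℝ satisfy ‖X‖_F = 1. Then for every ε > 0, ℙ(|trace(A(ω)ᵀ X)| < ε) ≤ √(2/π) · ε. In particular the Gaussian measurement ensemble satisfies the anti-concentration condition ℙ(|⟨Aᵢ, X⟩| < ε) ≤ Cε with C = √(2/π), uniformly over all unit-Frobenius-norm matrices X. -/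
open MeasureTheory ProbabilityTheory Matrix

/-- A linear combination of i.i.d. standard Gaussians is a centred Gaussian whose variance is the
sum of the squared coefficients. -/
theorem map_sum_mul_pi_gaussianReal {ι : Type*} [Fintype ι] (c : ι → ℝ) (v : NNReal)
    (hv : (v : ℝ) = ∑ i, c i ^ 2) :
    (Measure.pi fun _ : ι => gaussianReal 0 1).map (fun x => ∑ i, x i * c i)
      = gaussianReal 0 v := by
  have hmeas : Measurable fun x : ι → ℝ => ∑ i, x i * c i := by fun_prop
  have := Measure.isProbabilityMeasure_map (μ := Measure.pi fun _ : ι => gaussianReal 0 1)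
    hmeas.aemeasurable
  refine Measure.ext_of_charFun (funext fun t => ?_)
  have hprod (x : ι → ℝ) : Complex.exp (t * (∑ i, x i * c i : ℝ) * Complex.I)
      = ∏ i, Complex.exp ((t * c i : ℝ) * x i * Complex.I) := by
    rw [← Complex.exp_sum]
    push_cast
    rw [Finset.mul_sum, Finset.sum_mul]
    congr 1
    exact Finset.sum_congr rfl fun i _ => by ring
  rw [charFun_apply_real, integral_map hmeas.aemeasurable (by fun_prop)]
  simp_rw [hprod]
  rw [integral_fintype_prod_eq_prod
    (f := fun i (y : ℝ) => Complex.exp ((t * c i : ℝ) * y * Complex.I))]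
  simp_rw [← charFun_apply_real, charFun_gaussianReal]
  rw [← Complex.exp_sum]
  have hv' : (v : ℂ) = ∑ i, (c i : ℂ) ^ 2 := by exact_mod_cast congrArg Complex.ofReal hv
  rw [hv', Finset.sum_mul, Finset.sum_div]
  congr 1
  simp only [Complex.ofReal_zero, mul_zero, zero_mul, zero_sub, ← Finset.sum_neg_distrib]
  exact Finset.sum_congr rfl fun i _ => by push_cast; ring

/-- The density of the standard Gaussian is at most `1 / √(2π)`. -/
theorem gaussianPDFReal_zero_one_le (x : ℝ) :
    gaussianPDFReal 0 1 x ≤ (Real.sqrt (2 * Real.pi))⁻¹ := by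
  have hexp : Real.exp (-(x - 0) ^ 2 / (2 * ((1 : NNReal) : ℝ))) ≤ 1 := by
    rw [Real.exp_le_one_iff, neg_div]
    exact neg_nonpos.mpr (by positivity)
  rw [gaussianPDFReal_def]
  simpa using mul_le_of_le_one_right (by positivity : 0 ≤ (Real.sqrt (2 * Real.pi))⁻¹) hexp

/-- A standard Gaussian variable is smaller than `ε` in absolute value with probability at most
`√(2/π) · ε`. -/
theorem gaussianReal_abs_lt_le (ε : ℝ) :
    gaussianReal 0 1 {x | |x| < ε} ≤ ENNReal.ofReal (Real.sqrt (2 / Real.pi) * ε) := by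
  have hset : {x : ℝ | |x| < ε} = Set.Ioo (-ε) ε := by ext; simp [abs_lt]
  have hconst : (Real.sqrt (2 * Real.pi))⁻¹ * (ε - -ε) = Real.sqrt (2 / Real.pi) * ε := by
    have h2 : Real.sqrt 2 * Real.sqrt 2 = 2 := Real.mul_self_sqrt (by norm_num)
    rw [Real.sqrt_mul (by norm_num), Real.sqrt_div (by norm_num)]
    field_simp
    linear_combination (-ε) * h2
  rw [hset, gaussianReal_apply 0 one_ne_zero]
  calc ∫⁻ x in Set.Ioo (-ε) ε, gaussianPDF 0 1 x
      ≤ ∫⁻ _ in Set.Ioo (-ε) ε, ENNReal.ofReal (Real.sqrt (2 * Real.pi))⁻¹ :=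
        lintegral_mono fun x => ENNReal.ofReal_le_ofReal (gaussianPDFReal_zero_one_le x)
    _ = ENNReal.ofReal (Real.sqrt (2 / Real.pi) * ε) := by
        rw [setLIntegral_const, Real.volume_Ioo, ← ENNReal.ofReal_mul (by positivity), hconst]

theorem trace_transpose_mul_eq_sum_prod {m n : Type*} [Fintype m] [Fintype n]
    (A B : Matrix m n ℝ) :
    (Aᵀ * B).trace = ∑ p : m × n, A p.1 p.2 * B p.1 p.2 := by
  rw [Fintype.sum_prod_type_right]
  simp [Matrix.trace, Matrix.mul_apply]

/-- **Anti-concentration of Gaussian measurements.**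
If the `n²` entries of a random matrix `A` are i.i.d. standard Gaussians and `X` has
unit Frobenius norm, then `P(|trace (A(ω)ᵀ X)| < ε) ≤ √(2/π) · ε` for every `ε > 0`. -/
theorem gaussian_measurement_anticoncentration
    {Ω : Type*} [MeasurableSpace Ω] (P : Measure Ω) [IsProbabilityMeasure P]
    (n : ℕ) (hn : 0 < n)
    (A : Ω → Matrix (Fin n) (Fin n) ℝ)
    (hiid : Measure.map (fun ω => fun p : Fin n × Fin n => A ω p.1 p.2) P
      = Measure.pi fun _ : Fin n × Fin n => gaussianReal 0 1)
    (X : Matrix (Fin n) (Fin n) ℝ) (hX : Real.sqrt ((Xᵀ * X).trace) = 1)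
    (ε : ℝ) (hε : 0 < ε) :
    P {ω | |(((A ω)ᵀ * X)).trace| < ε} ≤ ENNReal.ofReal (Real.sqrt (2 / Real.pi) * ε) := by
  have hnorm : ((1 : NNReal) : ℝ) = ∑ p : Fin n × Fin n, X p.1 p.2 ^ 2 := by
    simp_rw [pow_two]
    rw [← trace_transpose_mul_eq_sum_prod, Real.sqrt_eq_one.mp hX, NNReal.coe_one]
  have hA : AEMeasurable (fun ω => fun p : Fin n × Fin n => A ω p.1 p.2) P :=
    AEMeasurable.of_map_ne_zero (hiid ▸ IsProbabilityMeasure.ne_zero _)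
  have hlin : Measurable fun x : Fin n × Fin n → ℝ => ∑ p, x p * X p.1 p.2 := by fun_prop
  have hball : MeasurableSet {y : ℝ | |y| < ε} := measurableSet_lt (by fun_prop) (by fun_prop)
  have hevent : {ω | |((A ω)ᵀ * X).trace| < ε} = (fun ω => fun p : Fin n × Fin n => A ω p.1 p.2) ⁻¹'
      ((fun x => ∑ p, x p * X p.1 p.2) ⁻¹' {y : ℝ | |y| < ε}) := by
    ext ω
    simp [trace_transpose_mul_eq_sum_prod]
  rw [hevent, ← Measure.map_apply_of_aemeasurable hA (hlin hball), hiid,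
    ← Measure.map_apply hlin hball, map_sum_mul_pi_gaussianReal _ 1 hnorm]
  exact gaussianReal_abs_lt_le ε
end
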